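/- arXiv:2307.13055 — 3 statements merged into one kernel-verified Lean document; each statement's English description precedes it below -/
import Mathlib

section
/- Let S be a measurable space, (Ω, μ) a probability space, G : Ω → S a measurable random data point, and Y : Ω → ℝ a measurable label with |Y| ≤ B μ-almost everywhere for some B ≥ 0. Let g : S → ℝ^d be a measurable representation with ‖g(s)‖ = 1 for every s ∈ S, and let p : ℝ^d → ℝ be a continuous linear functional with operator norm ‖p‖. Then for any two measurable augmentation maps τ, τ' : S → S, the variation of the squared-loss risk across the two augmentation-induced domains satisfies |E[(p(g(τ(G))) − Y)²] − E[(p(g(τ'(G))) − Y)²]| ≤ 2(‖p‖ + B)·‖p‖·E[‖g(τ(G)) − g(τ'(G))‖]. -/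
open MeasureTheory

/-- The squared loss of a bounded linear predictor is Lipschitz on the unit ball. -/
theorem abs_sq_loss_sub_le {E : Type*} [NormedAddCommGroup E] [NormedSpace ℝ E]
    (p : E →L[ℝ] ℝ) {u v : E} {y B : ℝ} (hu : ‖u‖ ≤ 1) (hv : ‖v‖ ≤ 1) (hy : |y| ≤ B) :
    |(p u - y) ^ 2 - (p v - y) ^ 2| ≤ 2 * (‖p‖ + B) * ‖p‖ * ‖u - v‖ := by
  have hpu : |p u| ≤ ‖p‖ := p.unit_le_opNorm u hu
  have hpv : |p v| ≤ ‖p‖ := p.unit_le_opNorm v hv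
  have hsub : |p (u - v)| ≤ ‖p‖ * ‖u - v‖ := p.le_opNorm (u - v)
  have hsum : |p u + p v - 2 * y| ≤ 2 * (‖p‖ + B) := by
    rw [abs_le] at *
    constructor <;> linarith
  have hfactor : (p u - y) ^ 2 - (p v - y) ^ 2 = (p u + p v - 2 * y) * p (u - v) := by
    rw [map_sub]
    ring
  rw [hfactor, abs_mul, mul_assoc (2 * (‖p‖ + B))]
  exact mul_le_mul hsum hsub (abs_nonneg _) ((abs_nonneg _).trans hsum)

/-- The squared loss of a bounded linear predictor is integrable for bounded features and labels. -/
theorem integrable_sq_loss {Ω E : Type*} [MeasurableSpace Ω] {μ : Measure Ω} [IsFiniteMeasure μ]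
    [NormedAddCommGroup E] [NormedSpace ℝ E] (p : E →L[ℝ] ℝ) {f : Ω → E} {Y : Ω → ℝ} {B : ℝ}
    (hf : AEStronglyMeasurable f μ) (hY : AEStronglyMeasurable Y μ)
    (hf1 : ∀ᵐ ω ∂μ, ‖f ω‖ ≤ 1) (hYB : ∀ᵐ ω ∂μ, |Y ω| ≤ B) :
    Integrable (fun ω ↦ (p (f ω) - Y ω) ^ 2) μ := by
  refine Integrable.of_bound
    (((p.continuous.comp_aestronglyMeasurable hf).sub hY).pow 2) ((‖p‖ + B) ^ 2) ?_
  filter_upwards [hf1, hYB] with ω hω hy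
  rw [norm_pow]
  gcongr
  exact (norm_sub_le _ _).trans (add_le_add (p.unit_le_opNorm _ hω) hy)

/-- Theorem 1 (first part): upper bound of the variation of the squared-loss risk
across two augmentation-induced domains. -/
theorem risk_variation_le
    {S : Type*} [MeasurableSpace S] {Ω : Type*} [MeasurableSpace Ω]
    (μ : Measure Ω) [IsProbabilityMeasure μ]
    {d : ℕ} (G : Ω → S) (hG : Measurable G)
    (Y : Ω → ℝ) (hY : Measurable Y)
    (B : ℝ) (hB : 0 ≤ B) (hYB : ∀ᵐ ω ∂μ, |Y ω| ≤ B)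
    (g : S → EuclideanSpace ℝ (Fin d)) (hg : Measurable g)
    (hgnorm : ∀ s, ‖g s‖ = 1)
    (p : EuclideanSpace ℝ (Fin d) →L[ℝ] ℝ)
    (τ τ' : S → S) (hτ : Measurable τ) (hτ' : Measurable τ') :
    |(∫ ω, (p (g (τ (G ω))) - Y ω) ^ 2 ∂μ) -
        ∫ ω, (p (g (τ' (G ω))) - Y ω) ^ 2 ∂μ| ≤
      2 * (‖p‖ + B) * ‖p‖ * ∫ ω, ‖g (τ (G ω)) - g (τ' (G ω))‖ ∂μ := by
  have hf : Measurable fun ω ↦ g (τ (G ω)) := hg.comp (hτ.comp hG)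
  have hf' : Measurable fun ω ↦ g (τ' (G ω)) := hg.comp (hτ'.comp hG)
  have hle (s : S) : ‖g s‖ ≤ 1 := (hgnorm s).le
  have hint := integrable_sq_loss p hf.aestronglyMeasurable hY.aestronglyMeasurable
    (ae_of_all μ fun ω ↦ hle (τ (G ω))) hYB
  have hint' := integrable_sq_loss p hf'.aestronglyMeasurable hY.aestronglyMeasurable
    (ae_of_all μ fun ω ↦ hle (τ' (G ω))) hYB
  have hdist : Integrable (fun ω ↦ ‖g (τ (G ω)) - g (τ' (G ω))‖) μ :=
    ((Integrable.of_bound hf.aestronglyMeasurable 1 (ae_of_all μ fun _ ↦ hle _)).sub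
      (Integrable.of_bound hf'.aestronglyMeasurable 1 (ae_of_all μ fun _ ↦ hle _))).norm
  rw [← integral_sub hint hint', ← integral_const_mul, ← Real.norm_eq_abs]
  refine norm_integral_le_of_norm_le (hdist.const_mul _) ?_
  filter_upwards [hYB] with ω hy
  exact abs_sq_loss_sub_le p (hle _) (hle _) hy
end

section
/- Let S be a measurable space, (Ω, μ) a probability space, G : Ω → S measurable, and Y : Ω → ℝ measurable with |Y| ≤ B μ-almost everywhere for some B ≥ 0. Let g : S → ℝ^d be measurable with ‖g(s)‖ = 1 for every s ∈ S, let τ, τ' : S → S be measurable augmentation maps, and let p_τ, p_{τ'} : ℝ^d → ℝ be continuous linear functionals such that p_τ is optimal on the τ-domain relative to p_{τ'} and p_{τ'} is optimal on the τ'-domain relative to p_τ, i.e., E[(p_τ(g(τ(G))) − Y)²] ≤ E[(p_{τ'}(g(τ(G))) − Y)²] and E[(p_{τ'}(g(τ'(G))) − Y)²] ≤ E[(p_τ(g(τ'(G))) − Y)²]. Then |E[(p_τ(g(τ'(G))) − Y)²] − E[(p_{τ'}(g(τ'(G))) − Y)²]| ≤ (2(‖p_τ‖ + B)·‖p_τ‖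 + 2(‖p_{τ'}‖ + B)·‖p_{τ'}‖)·E[‖g(τ(G)) − g(τ'(G))‖]. -/
open MeasureTheory

section LinearPredictor

variable {Ω : Type*} [MeasurableSpace Ω] {μ : Measure Ω}
  {E : Type*} [NormedAddCommGroup E] [NormedSpace ℝ E]

theorem ContinuousLinearMap.abs_apply_sub_le (p : E →L[ℝ] ℝ) {x : E} {y B : ℝ}
    (hx : ‖x‖ ≤ 1) (hy : |y| ≤ B) : |p x - y| ≤ ‖p‖ + B :=
  (abs_sub _ _).trans (add_le_add (p.unit_le_opNorm x hx) hy)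

theorem ContinuousLinearMap.integrable_sq_apply_sub [IsFiniteMeasure μ] (p : E →L[ℝ] ℝ)
    {u : Ω → E} {Y : Ω → ℝ} {B : ℝ} (hu : AEStronglyMeasurable u μ)
    (hY : AEStronglyMeasurable Y μ) (hu1 : ∀ᵐ ω ∂μ, ‖u ω‖ ≤ 1) (hYB : ∀ᵐ ω ∂μ, |Y ω| ≤ B) :
    Integrable (fun ω => (p (u ω) - Y ω) ^ 2) μ := by
  refine Integrable.of_bound
    (((p.continuous.comp_aestronglyMeasurable hu).sub hY).pow 2) ((‖p‖ + B) ^ 2) ?_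
  filter_upwards [hu1, hYB] with ω h1 hy
  rw [norm_pow, Real.norm_eq_abs]
  exact pow_le_pow_left₀ (abs_nonneg _) (p.abs_apply_sub_le h1 hy) 2

theorem ContinuousLinearMap.abs_sq_apply_sub_sub_le (p : E →L[ℝ] ℝ) {x x' : E} {y B : ℝ}
    (hx : ‖x‖ ≤ 1) (hx' : ‖x'‖ ≤ 1) (hy : |y| ≤ B) :
    |(p x - y) ^ 2 - (p x' - y) ^ 2| ≤ 2 * (‖p‖ + B) * ‖p‖ * ‖x - x'‖ := by
  have hsum : |(p x - y) + (p x' - y)| ≤ 2 * (‖p‖ + B) := by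
    linarith [abs_add_le (p x - y) (p x' - y), p.abs_apply_sub_le hx hy,
      p.abs_apply_sub_le hx' hy]
  have hdiff : |p (x - x')| ≤ ‖p‖ * ‖x - x'‖ := p.le_opNorm _
  calc |(p x - y) ^ 2 - (p x' - y) ^ 2|
      = |(p x - y) + (p x' - y)| * |p (x - x')| := by
        rw [← abs_mul, map_sub]
        ring_nf
    _ ≤ 2 * (‖p‖ + B) * (‖p‖ * ‖x - x'‖) :=
        mul_le_mul hsum hdiff (abs_nonneg _) ((abs_nonneg _).trans hsum)
    _ = 2 * (‖p‖ + B) * ‖p‖ * ‖x - x'‖ := by ring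

/-- The squared risk of a bounded linear predictor is Lipschitz in the representation. -/
theorem ContinuousLinearMap.abs_integral_sq_apply_sub_sub_le [IsFiniteMeasure μ]
    (p : E →L[ℝ] ℝ) {u v : Ω → E} {Y : Ω → ℝ} {B : ℝ} (hu : AEStronglyMeasurable u μ)
    (hv : AEStronglyMeasurable v μ) (hY : AEStronglyMeasurable Y μ)
    (hu1 : ∀ᵐ ω ∂μ, ‖u ω‖ ≤ 1) (hv1 : ∀ᵐ ω ∂μ, ‖v ω‖ ≤ 1) (hYB : ∀ᵐ ω ∂μ, |Y ω| ≤ B) :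
    |(∫ ω, (p (u ω) - Y ω) ^ 2 ∂μ) - ∫ ω, (p (v ω) - Y ω) ^ 2 ∂μ| ≤
      2 * (‖p‖ + B) * ‖p‖ * ∫ ω, ‖u ω - v ω‖ ∂μ := by
  have huv : Integrable (fun ω => u ω - v ω) μ :=
    (Integrable.of_bound hu 1 hu1).sub (Integrable.of_bound hv 1 hv1)
  rw [← integral_sub (p.integrable_sq_apply_sub hu hY hu1 hYB)
    (p.integrable_sq_apply_sub hv hY hv1 hYB), ← integral_const_mul, ← Real.norm_eq_abs]
  refine norm_integral_le_of_norm_le (huv.norm.const_mul _) ?_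
  filter_upwards [hu1, hv1, hYB] with ω h1 h2 hy
  exact p.abs_sq_apply_sub_sub_le h1 h2 hy

end LinearPredictor

/-- Theorem 1 (second part): a representation with small invariant alignment loss
elicits nearly the same optimal linear predictor across augmentation-induced domains. -/
theorem optimal_predictor_risk_variation_le
    {S : Type*} [MeasurableSpace S] {Ω : Type*} [MeasurableSpace Ω]
    (μ : Measure Ω) [IsProbabilityMeasure μ]
    {d : ℕ} (G : Ω → S) (hG : Measurable G)
    (Y : Ω → ℝ) (hY : Measurable Y)
    (B : ℝ) (hB : 0 ≤ B) (hYB : ∀ᵐ ω ∂μ, |Y ω| ≤ B)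
    (g : S → EuclideanSpace ℝ (Fin d)) (hg : Measurable g)
    (hgnorm : ∀ s, ‖g s‖ = 1)
    (τ τ' : S → S) (hτ : Measurable τ) (hτ' : Measurable τ')
    (pτ pτ' : EuclideanSpace ℝ (Fin d) →L[ℝ] ℝ)
    (hopt : (∫ ω, (pτ (g (τ (G ω))) - Y ω) ^ 2 ∂μ) ≤
      ∫ ω, (pτ' (g (τ (G ω))) - Y ω) ^ 2 ∂μ)
    (hopt' : (∫ ω, (pτ' (g (τ' (G ω))) - Y ω) ^ 2 ∂μ) ≤
      ∫ ω, (pτ (g (τ' (G ω))) - Y ω) ^ 2 ∂μ) :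
    |(∫ ω, (pτ (g (τ' (G ω))) - Y ω) ^ 2 ∂μ) -
        ∫ ω, (pτ' (g (τ' (G ω))) - Y ω) ^ 2 ∂μ| ≤
      (2 * (‖pτ‖ + B) * ‖pτ‖ + 2 * (‖pτ'‖ + B) * ‖pτ'‖) *
        ∫ ω, ‖g (τ (G ω)) - g (τ' (G ω))‖ ∂μ := by
  have hu : AEStronglyMeasurable (fun ω => g (τ (G ω))) μ :=
    (hg.comp (hτ.comp hG)).aestronglyMeasurable
  have hv : AEStronglyMeasurable (fun ω => g (τ' (G ω))) μ :=
    (hg.comp (hτ'.comp hG)).aestronglyMeasurable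
  have key (p : EuclideanSpace ℝ (Fin d) →L[ℝ] ℝ) :=
    p.abs_integral_sq_apply_sub_sub_le hu hv hY.aestronglyMeasurable
      (.of_forall fun _ => (hgnorm _).le) (.of_forall fun _ => (hgnorm _).le) hYB
  rw [abs_of_nonneg (sub_nonneg.2 hopt'), add_mul]
  linarith [(abs_le.1 (key pτ)).1, (abs_le.1 (key pτ')).2]
end

section
/- Let μ be the standard Gaussian measure on ℝ² (the law of (X₁, X₂) with X₁, X₂ independent standard real Gaussians). Then μ{x ∈ ℝ² : x₁ < 0 and x₁ + x₂ ≥ 0} + μ{x ∈ ℝ² : x₁ ≥ 0 and x₁ + x₂ < 0} = 1/4. -/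
open MeasureTheory ProbabilityTheory

/-- A centered real Gaussian charges the open negative and the closed positive half-line
equally. -/
lemma gaussianReal_zero_Iio_zero_eq_Ici_zero {v : NNReal} (hv : v ≠ 0) :
    gaussianReal 0 v (Set.Iio 0) = gaussianReal 0 v (Set.Ici 0) := by
  have := nullSingletonClass_gaussianReal (μ := 0) hv
  have hmap : (gaussianReal 0 v).map (fun x ↦ -x) = gaussianReal 0 v := by
    simpa using gaussianReal_map_neg (μ := 0) (v := v)
  conv_lhs => rw [← hmap, Measure.map_apply measurable_neg measurableSet_Iio]
  have hpre : (fun x : ℝ ↦ -x) ⁻¹' Set.Iio 0 = Set.Ioi 0 := by ext; simp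
  rw [hpre]
  exact measure_congr Ioi_ae_eq_Ici

lemma gaussianReal_zero_Ici_zero {v : NNReal} (hv : v ≠ 0) :
    gaussianReal 0 v (Set.Ici 0) = 2⁻¹ := by
  have h := prob_add_prob_compl (μ := gaussianReal 0 v) (measurableSet_Ici (a := (0 : ℝ)))
  rw [Set.compl_Ici, gaussianReal_zero_Iio_zero_eq_Ici_zero hv, ← mul_two] at h
  exact ENNReal.eq_inv_of_mul_eq_one_left h

/-- For a product of a measure with itself, the two half-plane disagreement regions have the
total mass of a quadrant: swapping the coordinates of the second region completes the first. -/
lemma prod_self_disagreement_eq_mul (ν : Measure ℝ) [SFinite ν] :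
    ν.prod ν {x : ℝ × ℝ | x.1 < 0 ∧ x.1 + x.2 ≥ 0} +
      ν.prod ν {x : ℝ × ℝ | x.1 ≥ 0 ∧ x.1 + x.2 < 0} =
      ν (Set.Iio 0) * ν (Set.Ici 0) := by
  have hm : MeasurableSet {x : ℝ × ℝ | x.1 ≥ 0 ∧ x.1 + x.2 < 0} :=
    (measurableSet_le measurable_const measurable_fst).inter
      (measurableSet_lt (measurable_fst.add measurable_snd) measurable_const)
  have hswap : ν.prod ν {x : ℝ × ℝ | x.1 ≥ 0 ∧ x.1 + x.2 < 0} =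
      ν.prod ν (Prod.swap ⁻¹' {x : ℝ × ℝ | x.1 ≥ 0 ∧ x.1 + x.2 < 0}) := by
    rw [← Measure.map_apply measurable_swap hm, Measure.prod_swap]
  rw [hswap, ← Measure.prod_prod, ← measure_union _ (measurable_swap hm)]
  · congr 1
    ext ⟨a, b⟩
    simp only [Set.mem_union, Set.mem_ofPred_eq, Set.mem_preimage, Prod.swap, Set.mem_prod,
      Set.mem_Iio, Set.mem_Ici]
    grind
  · refine Set.disjoint_left.2 ?_
    rintro ⟨a, b⟩ ⟨_, h⟩ ⟨_, h'⟩
    simp only [Prod.swap] at h h'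
    linarith

/-- The 0-1 risk of the classifier `x ↦ 1{x₁ + x₂ ≥ 0}` against the label
`y(x) = 1{x₁ ≥ 0}` under the standard Gaussian measure on `ℝ²` equals `1/4`. -/
theorem gaussian_disagreement_measure_eq_quarter :
    (gaussianReal 0 1).prod (gaussianReal 0 1)
        {x : ℝ × ℝ | x.1 < 0 ∧ x.1 + x.2 ≥ 0} +
      (gaussianReal 0 1).prod (gaussianReal 0 1)
        {x : ℝ × ℝ | x.1 ≥ 0 ∧ x.1 + x.2 < 0} = 1 / 4 := by
  rw [prod_self_disagreement_eq_mul, gaussianReal_zero_Iio_zero_eq_Ici_zero one_ne_zero,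
    gaussianReal_zero_Ici_zero one_ne_zero, ← ENNReal.mul_inv (by simp) (by simp), one_div]
  norm_num
end
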